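/- Let λ ∈ ℝ, p ∈ (2, 2*_α], and let Ω ⊂⊂ D be bounded smooth domains in ℝ^N. Let A > 0 satisfy ||t|^{p−2}t + λt| ≤ 2|t|^{2*_α−1} + A for all t ∈ ℝ. Let v be a classical solution of the extension problem on C_Ω with exponent p and parameter λ, extend v(·,0) by zero to D, and let w ≥ 0 be a classical solution of the linear extension problem on C_D with Neumann datum 2|v(x,0)|^{2*_α−1} + A. Then |v(X)| ≤ w(X) for every X in the closure of C_Ω. -/

import Mathlib

open MeasureTheory Metric Set Filter Topology RealInnerProductSpace

noncomputable section

/-- Euclidean space ℝ^n. -/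
abbrev Euc (n : ℕ) : Type := EuclideanSpace ℝ (Fin n)

/-- Pair `x ∈ ℝ^N` with `y ∈ ℝ` to get the point `X = (x, y)` of `ℝ^{N+1}`. -/
def pt {N : ℕ} (x : Euc N) (y : ℝ) : Euc (N + 1) :=
  (EuclideanSpace.equiv (Fin (N + 1)) ℝ).symm (Fin.snoc (EuclideanSpace.equiv (Fin N) ℝ x) y)

/-- The last coordinate (the "y" variable) of a point of `ℝ^{N+1}`. -/
def yc {N : ℕ} (X : Euc (N + 1)) : ℝ := X (Fin.last N)

/-- The first `N` coordinates (the "x" variable) of a point of `ℝ^{N+1}`. -/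
def xc {N : ℕ} (X : Euc (N + 1)) : Euc N :=
  (EuclideanSpace.equiv (Fin N) ℝ).symm (fun i => X i.castSucc)

/-- The cylinder `C_D = D × (0, ∞) ⊆ ℝ^{N+1}`. -/
def cyl {N : ℕ} (D : Set (Euc N)) : Set (Euc (N + 1)) :=
  {X | xc X ∈ D ∧ 0 < yc X}

/-- The open upper half-space `ℝ^{N+1}_+`. -/
def upperHalf (N : ℕ) : Set (Euc (N + 1)) := {X | 0 < yc X}

/-- Divergence of a vector field on `ℝ^{N+1}`. -/
def dvg {N : ℕ} (F : Euc (N + 1) → Euc (N + 1)) (X : Euc (N + 1)) : ℝ :=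
  ∑ i, fderiv ℝ F X (EuclideanSpace.single i 1) i

/-- The weighted gradient field `y^{1-2α} ∇v`. -/
def wgrad {N : ℕ} (α : ℝ) (v : Euc (N + 1) → ℝ) (X : Euc (N + 1)) : Euc (N + 1) :=
  (yc X ^ (1 - 2 * α)) • gradient v X

/-- The critical exponent `2*_α = 2N/(N - 2α)`. -/
def critExp (N : ℕ) (α : ℝ) : ℝ := 2 * N / (N - 2 * α)

/-- The weighted Dirichlet energy density `y^{1-2α} |∇v|²`. -/
def eDen {N : ℕ} (α : ℝ) (v : Euc (N + 1) → ℝ) (X : Euc (N + 1)) : ℝ :=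
  yc X ^ (1 - 2 * α) * ‖gradient v X‖ ^ 2

/-- `lim_{y→0⁺} y^{1-2α} ∂v/∂y (x, y) = L`. -/
def NeumannLim {N : ℕ} (α : ℝ) (v : Euc (N + 1) → ℝ) (x : Euc N) (L : ℝ) : Prop :=
  Tendsto (fun y : ℝ =>
      y ^ (1 - 2 * α) * fderiv ℝ v (pt x y) (EuclideanSpace.single (Fin.last N) 1))
    (nhdsWithin 0 (Set.Ioi 0)) (nhds L)

/-- A classical solution of the extension problem on `C_Ω` with exponent `p` and
parameter `lam`. -/
structure ExtSol (N : ℕ) (α lam p : ℝ) (Ω : Set (Euc N)) (v : Euc (N + 1) → ℝ) : Prop where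
  cont : ContinuousOn v (closure (cyl Ω))
  smooth : ContDiffOn ℝ 2 v (cyl Ω)
  energy : IntegrableOn (eDen α v) (cyl Ω)
  pde : ∀ X ∈ cyl Ω, dvg (wgrad α v) X = 0
  lateral : ∀ x ∈ frontier Ω, ∀ y : ℝ, 0 < y → v (pt x y) = 0
  neumann : ∀ x ∈ Ω,
    NeumannLim α v x (-(|v (pt x 0)| ^ (p - 2) * v (pt x 0) + lam * v (pt x 0)))

/-- A classical solution of the linear extension problem on `C_D` with Neumann datum `f`. -/
structure LinSol (N : ℕ) (α : ℝ) (D : Set (Euc N)) (f : Euc N → ℝ) (w : Euc (N + 1) → ℝ) :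
    Prop where
  cont : ContinuousOn w (closure (cyl D))
  smooth : ContDiffOn ℝ 2 w (cyl D)
  energy : IntegrableOn (eDen α w) (cyl D)
  pde : ∀ X ∈ cyl D, dvg (wgrad α w) X = 0
  lateral : ∀ x ∈ frontier D, ∀ y : ℝ, 0 < y → w (pt x y) = 0
  neumann : ∀ x ∈ D, NeumannLim α w x (-(f x))

/-- A finite-energy solution of the bubble problem on the half-space with coefficient `b`. -/
structure BubbleSol (N : ℕ) (α b : ℝ) (W : Euc (N + 1) → ℝ) : Prop where
  cont : ContinuousOn W {X | 0 ≤ yc X}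
  smooth : ContDiffOn ℝ 2 W (upperHalf N)
  energy : IntegrableOn (eDen α W) (upperHalf N)
  pde : ∀ X ∈ upperHalf N, dvg (wgrad α W) X = 0
  neumann : ∀ x : Euc N,
    NeumannLim α W x (-(b * (|W (pt x 0)| ^ (critExp N α - 2) * W (pt x 0))))

/-- The rescaling `ρ_{x,σ}(W)(X) = σ^{(N-2α)/2} W(σ(X - (x,0)))`. -/
def resc {N : ℕ} (α : ℝ) (x : Euc N) (σ : ℝ) (W : Euc (N + 1) → ℝ) (X : Euc (N + 1)) : ℝ :=
  σ ^ (((N : ℝ) - 2 * α) / 2) * W (σ • (X - pt x 0))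

/-- A profile decomposition of the sequence `v` with `k` bubbles. -/
structure ProfileDecomp (N : ℕ) (α lam : ℝ) (Ω : Set (Euc N)) (v : ℕ → Euc (N + 1) → ℝ)
    (v₀ : Euc (N + 1) → ℝ) (k : ℕ) (b : Fin k → ℝ) (W : Fin k → Euc (N + 1) → ℝ)
    (xb : ℕ → Fin k → Euc N) (σ : ℕ → Fin k → ℝ) : Prop where
  sol0 : ExtSol N α lam (critExp N α) Ω v₀
  beta_mem : ∀ j, b j ∈ Set.Ioc (0 : ℝ) 1
  bubble : ∀ j, BubbleSol N α (b j) (W j)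
  nontriv : ∀ j, ∃ X, 0 ≤ yc X ∧ W j X ≠ 0
  center_mem : ∀ n j, xb n j ∈ Ω
  scale_pos : ∀ n j, 0 < σ n j
  scale_dist : ∀ j, Tendsto (fun n => σ n j * Metric.infDist (xb n j) (frontier Ω)) atTop atTop
  separation : ∀ i j, i ≠ j →
    Tendsto (fun n => σ n j / σ n i + σ n i / σ n j
      + σ n i * σ n j * dist (xb n i) (xb n j) ^ 2) atTop atTop
  remainder : Tendsto (fun n => ∫ X in upperHalf N,
      eDen α (fun Z => v n Z - v₀ Z - ∑ j, resc α (xb n j) (σ n j) (W j) Z) X) atTop (nhds 0)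

/-- The mixed `(q₁, q₂, σ)` norm of `u` on `D`. -/
def mixedNorm (N : ℕ) (α : ℝ) (D : Set (Euc N)) (q₁ q₂ σ : ℝ) (u : Euc N → ℝ) : ℝ :=
  sInf {β : ℝ | 0 < β ∧ ∃ u₁ u₂ : Euc N → ℝ,
    (∀ x ∈ D, 0 ≤ u₁ x) ∧ (∀ x ∈ D, 0 ≤ u₂ x) ∧ (∀ x ∈ D, |u x| ≤ u₁ x + u₂ x) ∧
    eLpNorm u₁ (ENNReal.ofReal q₁) (volume.restrict D) ≤ ENNReal.ofReal β ∧
    eLpNorm u₂ (ENNReal.ofReal q₂) (volume.restrict D) ≤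
      ENNReal.ofReal (β * σ ^ ((N : ℝ) / critExp N α - (N : ℝ) / q₂))}

section Preparation

variable {N : ℕ}

section Coordinates

@[simp] lemma xc_pt (x : Euc N) (y : ℝ) : xc (pt x y) = x := by
  ext i; simp [xc, pt]

@[simp] lemma yc_pt (x : Euc N) (y : ℝ) : yc (pt x y) = y := by
  simp [yc, pt]

@[simp] lemma pt_xc_yc (X : Euc (N + 1)) : pt (xc X) (yc X) = X := by
  ext i
  refine Fin.lastCases ?_ (fun j => ?_) i <;> simp [xc, yc, pt]

lemma continuous_xc : Continuous (xc : Euc (N + 1) → Euc N) := by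
  unfold xc; fun_prop

lemma continuous_yc : Continuous (yc : Euc (N + 1) → ℝ) := by
  unfold yc; fun_prop

lemma continuous_pt : Continuous (fun q : Euc N × ℝ => pt q.1 q.2) := by
  unfold pt
  refine (EuclideanSpace.equiv (Fin (N + 1)) ℝ).symm.continuous.comp ?_
  refine continuous_pi fun i => ?_
  refine Fin.lastCases ?_ (fun j => ?_) i
  · simpa using continuous_snd
  · simp only [Fin.snoc_castSucc]
    fun_prop

/-- The splitting `ℝ^{N+1} ≃ ℝ^N × ℝ` into horizontal and vertical coordinates. -/
def splitHomeo (N : ℕ) : Euc (N + 1) ≃ₜ Euc N × ℝ where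
  toFun X := (xc X, yc X)
  invFun q := pt q.1 q.2
  left_inv X := by simp
  right_inv q := by simp
  continuous_toFun := continuous_xc.prodMk continuous_yc
  continuous_invFun := continuous_pt

lemma measurePreserving_splitHomeo (N : ℕ) :
    MeasurePreserving (splitHomeo N) volume (volume.prod volume) := by
  have h1 := PiLp.volume_preserving_ofLp (Fin (N + 1))
  have h2 := volume_preserving_piFinSuccAbove (fun _ : Fin (N + 1) => ℝ) (Fin.last N)
  have h3 : MeasurePreserving (Prod.swap : ℝ × (Fin N → ℝ) → _) (volume.prod volume)
    (volume.prod volume) := Measure.measurePreserving_swap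
  have h4 := (PiLp.volume_preserving_toLp (Fin N)).prod (MeasurePreserving.id (volume : Measure ℝ))
  have h := h4.comp (h3.comp (h2.comp h1))
  have he : ⇑(splitHomeo N) = Prod.map (WithLp.toLp 2) id ∘ Prod.swap ∘
      MeasurableEquiv.piFinSuccAbove (fun _ : Fin (N + 1) => ℝ) (Fin.last N) ∘ WithLp.ofLp := by
    funext X
    refine Prod.ext ?_ ?_
    · ext i
      simp [splitHomeo, xc, MeasurableEquiv.piFinSuccAbove, Fin.init]
    · simp [splitHomeo, yc, MeasurableEquiv.piFinSuccAbove]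
  rw [he]
  exact h

lemma cyl_eq_preimage (S : Set (Euc N)) : cyl S = splitHomeo N ⁻¹' (S ×ˢ Ioi 0) := by
  ext X; simp [cyl, splitHomeo]

lemma isOpen_cyl {S : Set (Euc N)} (hS : IsOpen S) : IsOpen (cyl S) := by
  rw [cyl_eq_preimage]
  exact (hS.prod isOpen_Ioi).preimage (splitHomeo N).continuous

lemma isOpen_upperHalf : IsOpen (upperHalf N) := isOpen_lt continuous_const continuous_yc

lemma mem_closure_cyl {S : Set (Euc N)} {X : Euc (N + 1)} :
    X ∈ closure (cyl S) ↔ xc X ∈ closure S ∧ 0 ≤ yc X := by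
  rw [cyl_eq_preimage, ← Homeomorph.preimage_closure, closure_prod_eq, closure_Ioi]
  simp [splitHomeo]

lemma sub_pt (X : Euc (N + 1)) (ξ : Euc N) : X - pt ξ 0 = pt (xc X - ξ) (yc X) := by
  ext i
  refine Fin.lastCases ?_ (fun j => ?_) i <;> simp [xc, yc, pt]

lemma pt_add_smul_last (x : Euc N) (y t : ℝ) :
    pt x y + t • EuclideanSpace.single (Fin.last N) 1 = pt x (y + t) := by
  ext i
  refine Fin.lastCases ?_ (fun j => ?_) i
  · simp [pt]
  · simp [pt, Fin.castSucc_ne_last]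

lemma hasDerivAt_pt (x : Euc N) (y : ℝ) :
    HasDerivAt (fun t => pt x t) (EuclideanSpace.single (Fin.last N) 1) y := by
  have h : (fun t => pt x t) =
      fun t : ℝ => pt x 0 + t • EuclideanSpace.single (Fin.last N) (1 : ℝ) := by
    funext t; rw [pt_add_smul_last, zero_add]
  rw [h]
  simpa using ((hasDerivAt_id y).smul_const (EuclideanSpace.single (Fin.last N) (1 : ℝ))).const_add
    (pt x 0)

lemma norm_sq_eq (X : Euc (N + 1)) : ‖X‖ ^ 2 = ‖xc X‖ ^ 2 + yc X ^ 2 := by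
  simp [EuclideanSpace.norm_sq_eq, Fin.sum_univ_castSucc, xc, yc]

end Coordinates

section WeightedLaplacian

/-- `f` has weighted Laplacian `Δf + ((1 - 2α)/y) ∂_y f` equal to `l` at `X`, computed with
iterated directional derivatives. -/
def HasWLap (α : ℝ) (f : Euc (N + 1) → ℝ) (X : Euc (N + 1)) (l : ℝ) : Prop :=
  ∃ (d : Fin (N + 1) → Euc (N + 1) → ℝ) (s : Fin (N + 1) → ℝ),
    (∀ i, ∀ᶠ Z in 𝓝 X, HasLineDerivAt ℝ f (d i Z) Z (EuclideanSpace.single i 1)) ∧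
    (∀ i, HasLineDerivAt ℝ (d i) (s i) X (EuclideanSpace.single i 1)) ∧
    ∑ i, s i + (1 - 2 * α) / yc X * d (Fin.last N) X = l

variable {α : ℝ} {f g : Euc (N + 1) → ℝ} {X : Euc (N + 1)} {l m : ℝ}

lemma HasWLap.add (hf : HasWLap α f X l) (hg : HasWLap α g X m) :
    HasWLap α (fun Z => f Z + g Z) X (l + m) := by
  obtain ⟨d, s, h1, h2, rfl⟩ := hf
  obtain ⟨d', s', h1', h2', rfl⟩ := hg
  refine ⟨fun i Z => d i Z + d' i Z, fun i => s i + s' i, fun i => ?_, fun i => ?_, ?_⟩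
  · filter_upwards [h1 i, h1' i] with Z hZ hZ' using HasDerivAt.add hZ hZ'
  · exact HasDerivAt.add (h2 i) (h2' i)
  · rw [Finset.sum_add_distrib]; ring

lemma HasWLap.const_mul (c : ℝ) (hf : HasWLap α f X l) :
    HasWLap α (fun Z => c * f Z) X (c * l) := by
  obtain ⟨d, s, h1, h2, rfl⟩ := hf
  refine ⟨fun i Z => c * d i Z, fun i => c * s i, fun i => ?_, fun i => ?_, ?_⟩
  · filter_upwards [h1 i] with Z hZ using HasDerivAt.const_mul c hZ
  · exact HasDerivAt.const_mul c (h2 i)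
  · rw [← Finset.mul_sum]; ring

lemma hasWLap_const (c : ℝ) : HasWLap α (fun _ => c) X 0 := by
  refine ⟨fun _ _ => 0, fun _ => 0, fun i => .of_forall fun Z => ?_, fun i => ?_, by simp⟩ <;>
  exact hasDerivAt_const _ _

lemma HasWLap.congr (hf : HasWLap α f X l) (h : g =ᶠ[𝓝 X] f) : HasWLap α g X l := by
  obtain ⟨d, s, h1, h2, h3⟩ := hf
  refine ⟨d, s, fun i => ?_, h2, h3⟩
  filter_upwards [h1 i, h.eventuallyEq_nhds] with Z hZ hZ' using hZ.congr_of_eventuallyEq hZ'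

lemma tendsto_line (X e : Euc (N + 1)) : Tendsto (fun t : ℝ => X + t • e) (𝓝 0) (𝓝 X) := by
  have : Continuous (fun t : ℝ => X + t • e) := by fun_prop
  simpa using this.tendsto 0

/-- At a line derivative `d i` in a neighbourhood, the restriction to the line is differentiable
at nearby parameters. -/
lemma eventually_hasDerivAt_line {d : Euc (N + 1) → ℝ} {e : Euc (N + 1)}
    (h : ∀ᶠ Z in 𝓝 X, HasLineDerivAt ℝ f (d Z) Z e) :
    ∀ᶠ t in 𝓝 (0 : ℝ), HasDerivAt (fun t => f (X + t • e)) (d (X + t • e)) t := by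
  filter_upwards [(tendsto_line X e).eventually h] with t ht
  have ht' : HasDerivAt (fun r : ℝ => f (X + t • e + r • e)) (d (X + t • e)) (t - t) := by
    simpa [HasLineDerivAt] using ht
  have := ht'.comp_sub_const t t
  refine this.congr_of_eventuallyEq (.of_forall fun r => ?_)
  simp only
  congr 1
  module

lemma second_deriv_nonneg_of_isLocalMin {φ φ' : ℝ → ℝ} {s : ℝ}
    (h1 : ∀ᶠ t in 𝓝 (0 : ℝ), HasDerivAt φ (φ' t) t) (h2 : HasDerivAt φ' s 0)
    (hmin : IsLocalMin φ 0) : φ' 0 = 0 ∧ 0 ≤ s := by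
  have h0 : φ' 0 = 0 := hmin.hasDerivAt_eq_zero h1.self_of_nhds
  refine ⟨h0, ?_⟩
  have hd : deriv φ =ᶠ[𝓝 0] φ' := h1.mono fun t ht => ht.deriv
  have hdd : deriv (deriv φ) 0 = s := (h2.congr_of_eventuallyEq hd).deriv
  by_contra! hs
  have hmax := isLocalMax_of_deriv_deriv_neg (f := φ) (x₀ := 0) (by rw [hdd]; exact hs)
    (by rw [h1.self_of_nhds.deriv, h0]) h1.self_of_nhds.continuousAt
  have hc : φ =ᶠ[𝓝 0] fun _ => φ 0 := by
    filter_upwards [hmin, hmax] with t h h' using le_antisymm h' h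
  have hz : deriv φ =ᶠ[𝓝 0] fun _ => 0 := by
    filter_upwards [hc.eventuallyEq_nhds] with t ht
    rw [ht.deriv_eq, deriv_const]
  rw [hz.deriv_eq, deriv_const] at hdd
  exact hs.ne hdd.symm

lemma HasWLap.nonneg_of_isLocalMin (hf : HasWLap α f X l) (hmin : IsLocalMin f X) : 0 ≤ l := by
  obtain ⟨d, s, h1, h2, rfl⟩ := hf
  have key : ∀ i, d i X = 0 ∧ 0 ≤ s i := fun i => by
    have := second_deriv_nonneg_of_isLocalMin (eventually_hasDerivAt_line (h1 i)) (h2 i) (by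
      have := (tendsto_line X (EuclideanSpace.single i 1)).eventually hmin
      simpa [IsLocalMin, IsMinFilter] using this)
    simpa using this
  rw [(key _).1, mul_zero, add_zero]
  exact Finset.sum_nonneg fun i _ => (key i).2

/-- Weighted Laplacian written with iterated Fréchet derivatives. -/
def wLap (α : ℝ) (f : Euc (N + 1) → ℝ) (X : Euc (N + 1)) : ℝ :=
  ∑ i, fderiv ℝ (fun Z => fderiv ℝ f Z (EuclideanSpace.single i 1)) X (EuclideanSpace.single i 1)
    + (1 - 2 * α) / yc X * fderiv ℝ f X (EuclideanSpace.single (Fin.last N) 1)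

lemma contDiffAt_fderiv_apply (hf : ContDiffAt ℝ 2 f X) (e : Euc (N + 1)) :
    ContDiffAt ℝ 1 (fun Z => fderiv ℝ f Z e) X :=
  (hf.fderiv_right (m := 1) (by norm_num)).clm_apply contDiffAt_const

lemma hasWLap_wLap (hf : ContDiffAt ℝ 2 f X) : HasWLap α f X (wLap α f X) := by
  refine ⟨fun i Z => fderiv ℝ f Z (EuclideanSpace.single i 1), _, fun i => ?_, fun i => ?_, rfl⟩
  · filter_upwards [hf.eventually (by simp)] with Z hZ
    exact (hZ.differentiableAt (by simp)).hasFDerivAt.hasLineDerivAt _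
  · exact ((contDiffAt_fderiv_apply hf _).differentiableAt (by simp)).hasFDerivAt.hasLineDerivAt _

lemma HasWLap.unique (hf : HasWLap α f X l) (hg : HasWLap α f X m) : l = m := by
  obtain ⟨d, s, h1, h2, rfl⟩ := hf
  obtain ⟨d', s', h1', h2', rfl⟩ := hg
  have key : ∀ i, d i =ᶠ[𝓝 X] d' i := fun i => by
    filter_upwards [h1 i, h1' i] with Z hZ hZ' using hZ.unique hZ'
  have hs : s = s' := funext fun i => (h2 i).unique ((h2' i).congr_of_eventuallyEq (key i))
  rw [hs, (key _).self_of_nhds]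

lemma gradient_apply (f : Euc (N + 1) → ℝ) (Z : Euc (N + 1)) (i : Fin (N + 1)) :
    gradient f Z i = fderiv ℝ f Z (EuclideanSpace.single i 1) := by
  have := InnerProductSpace.toDual_symm_apply (𝕜 := ℝ) (x := EuclideanSpace.single i (1 : ℝ))
    (y := fderiv ℝ f Z)
  rw [← this, EuclideanSpace.inner_single_right]
  simp [gradient]

lemma hasFDerivAt_yc (X : Euc (N + 1)) :
    HasFDerivAt (yc : Euc (N + 1) → ℝ)
      (EuclideanSpace.proj (Fin.last N) : Euc (N + 1) →L[ℝ] ℝ) X :=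
  (EuclideanSpace.proj (Fin.last N) : Euc (N + 1) →L[ℝ] ℝ).hasFDerivAt

/-- For `C²` functions the divergence-form equation is the vanishing of the weighted Laplacian. -/
lemma wLap_eq_zero (hf : ContDiffAt ℝ 2 f X) (hX : 0 < yc X) (h : dvg (wgrad α f) X = 0) :
    wLap α f X = 0 := by
  have hy : HasFDerivAt (fun Z : Euc (N + 1) => yc Z ^ (1 - 2 * α))
      (((1 - 2 * α) * yc X ^ (1 - 2 * α - 1)) •
        (EuclideanSpace.proj (Fin.last N) : Euc (N + 1) →L[ℝ] ℝ)) X :=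
    (hasFDerivAt_yc X).rpow_const (Or.inl hX.ne')
  rw [Real.rpow_sub_one hX.ne'] at hy
  have hD : ∀ i, DifferentiableAt ℝ (fun Z => fderiv ℝ f Z (EuclideanSpace.single i 1)) X :=
    fun i => (contDiffAt_fderiv_apply hf _).differentiableAt (by simp)
  have hcomp : ∀ i, (fun Z => wgrad α f Z i) =
      fun Z => yc Z ^ (1 - 2 * α) * fderiv ℝ f Z (EuclideanSpace.single i 1) := fun i => by
    funext Z
    simp [wgrad, gradient_apply]
  have hF : ∀ i, DifferentiableAt ℝ (fun Z => wgrad α f Z i) X := fun i => by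
    rw [hcomp]; exact (hy.mul (hD i).hasFDerivAt).differentiableAt
  have hW : DifferentiableAt ℝ (wgrad α f) X :=
    (differentiableAt_euclidean (𝕜 := ℝ)).2 hF
  have hdvg : dvg (wgrad α f) X = yc X ^ (1 - 2 * α) * wLap α f X := by
    have : ∀ i, fderiv ℝ (wgrad α f) X (EuclideanSpace.single i 1) i =
        fderiv ℝ (fun Z => wgrad α f Z i) X (EuclideanSpace.single i 1) := fun i => by
      have h1 : HasFDerivAt (fun Z => wgrad α f Z i)
          ((EuclideanSpace.proj i : Euc (N + 1) →L[ℝ] ℝ).comp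
            (fderiv ℝ (wgrad α f) X)) X :=
        (EuclideanSpace.proj i : Euc (N + 1) →L[ℝ] ℝ).hasFDerivAt.comp X
          hW.hasFDerivAt
      rw [h1.fderiv]; rfl
    have hterm : ∀ i, fderiv ℝ (wgrad α f) X (EuclideanSpace.single i 1) i =
        yc X ^ (1 - 2 * α) * fderiv ℝ (fun Z => fderiv ℝ f Z (EuclideanSpace.single i 1)) X
          (EuclideanSpace.single i 1) + (if i = Fin.last N then yc X ^ (1 - 2 * α) *
          ((1 - 2 * α) / yc X * fderiv ℝ f X (EuclideanSpace.single i 1)) else 0) := fun i => by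
      rw [this, hcomp, (hy.fun_mul (hD i).hasFDerivAt).fderiv]
      by_cases hi : i = Fin.last N
      · subst hi
        simp
        ring
      · simp [hi, Ne.symm hi]
    simp only [dvg, wLap, hterm, Finset.sum_add_distrib, ← Finset.mul_sum, Finset.sum_ite_eq',
      Finset.mem_univ, if_true, mul_add]
  rw [hdvg] at h
  exact (mul_eq_zero.1 h).resolve_left (Real.rpow_pos_of_pos hX _).ne'

end WeightedLaplacian

section Barrier

variable {α : ℝ} {f : Euc (N + 1) → ℝ} {X : Euc (N + 1)}

lemma yc_add_smul (X : Euc (N + 1)) (i : Fin (N + 1)) (t : ℝ) :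
    yc (X + t • EuclideanSpace.single i 1) = yc X + if i = Fin.last N then t else 0 := by
  rcases eq_or_ne i (Fin.last N) with rfl | h
  · simp [yc]
  · simp [yc, h, h.symm]

lemma hasWLap_comp_yc {g g' : ℝ → ℝ} {g'' : ℝ}
    (h1 : ∀ᶠ t in 𝓝 (yc X), HasDerivAt g (g' t) t) (h2 : HasDerivAt g' g'' (yc X)) :
    HasWLap α (fun Z => g (yc Z)) X (g'' + (1 - 2 * α) / yc X * g' (yc X)) := by
  have line : ∀ {k : ℝ → ℝ} {k' : ℝ} {Z : Euc (N + 1)}, HasDerivAt k k' (yc Z) →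
      HasLineDerivAt ℝ (fun Z => k (yc Z)) k' Z (EuclideanSpace.single (Fin.last N) 1) := by
    intro k k' Z hk
    simp only [HasLineDerivAt, yc_add_smul, if_true]
    simpa using HasDerivAt.comp_const_add (yc Z) 0 (by simpa using hk)
  refine ⟨fun i Z => if i = Fin.last N then g' (yc Z) else 0,
    fun i => if i = Fin.last N then g'' else 0, fun i => ?_, fun i => ?_, by simp⟩
  · filter_upwards [continuous_yc.continuousAt.eventually h1] with Z hZ
    by_cases hi : i = Fin.last N
    · subst hi
      simpa using line hZ
    · simp only [HasLineDerivAt, yc_add_smul, hi, if_false, add_zero]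
      exact hasDerivAt_const _ _
  · by_cases hi : i = Fin.last N
    · subst hi
      simpa using line h2
    · simp only [hi, if_false]
      exact hasDerivAt_const _ _

lemma hasWLap_norm_sq (hX : 0 < yc X) :
    HasWLap α (fun Z => ‖Z‖ ^ 2) X (2 * (N + 1) + 2 * (1 - 2 * α)) := by
  have hcoord : ∀ (Z : Euc (N + 1)) (i : Fin (N + 1)),
      HasLineDerivAt ℝ (fun Z : Euc (N + 1) => 2 * Z i) 2 Z (EuclideanSpace.single i 1) := by
    intro Z i
    have : HasDerivAt (fun t : ℝ => 2 * (Z i + t)) (2 * 1) 0 :=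
      ((hasDerivAt_id (0 : ℝ)).const_add (Z i)).const_mul 2
    simpa [HasLineDerivAt] using this
  refine ⟨fun i Z => 2 * Z i, fun _ => 2, fun i => .of_forall fun Z => ?_, fun i => hcoord X i, ?_⟩
  · have h := ((hasStrictFDerivAt_norm_sq Z).hasFDerivAt).hasLineDerivAt
      (EuclideanSpace.single i (1 : ℝ))
    simpa [EuclideanSpace.inner_single_right] using h
  · have : X (Fin.last N) = yc X := rfl
    simp [this]
    field_simp

/-- A supersolution growing quadratically in the vertical variable. -/
def barrier (α C : ℝ) (X : Euc (N + 1)) : ℝ :=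
  C - ‖X‖ ^ 2 + (5 / 4 * yc X ^ 2 - yc X ^ (2 * α))

lemma hasWLap_barrier (C : ℝ) (hX : 0 < yc X) :
    HasWLap α (barrier α C) X (-2 * N + (1 - α)) := by
  have h1 : ∀ᶠ t in 𝓝 (yc X), HasDerivAt (fun t : ℝ => 5 / 4 * t ^ 2 - t ^ (2 * α))
      (5 / 2 * t - 2 * α * t ^ (2 * α - 1)) t := by
    filter_upwards [lt_mem_nhds hX] with t ht
    refine (((hasDerivAt_pow 2 t).const_mul (5 / 4)).fun_sub
      (Real.hasDerivAt_rpow_const (p := 2 * α) (Or.inl ht.ne'))).congr_deriv ?_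
    norm_num
    ring
  have h2 : HasDerivAt (fun t : ℝ => 5 / 2 * t - 2 * α * t ^ (2 * α - 1))
      (5 / 2 * 1 - 2 * α * ((2 * α - 1) * yc X ^ (2 * α - 1 - 1))) (yc X) :=
    ((hasDerivAt_id (yc X)).const_mul (5 / 2)).sub
      ((Real.hasDerivAt_rpow_const (Or.inl hX.ne')).const_mul (2 * α))
  have h := ((hasWLap_const (α := α) (X := X) C).add
    ((hasWLap_norm_sq (α := α) hX).const_mul (-1))).add (hasWLap_comp_yc (α := α) h1 h2)
  have hf : barrier α C = fun Z : Euc (N + 1) =>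
      C + -1 * ‖Z‖ ^ 2 + (5 / 4 * yc Z ^ 2 - yc Z ^ (2 * α)) := by
    funext Z; simp only [barrier]; ring
  rw [hf]
  convert h using 1
  rw [Real.rpow_sub_one hX.ne' (2 * α - 1)]
  field_simp
  ring

lemma continuous_barrier (hα : 0 < α) (C : ℝ) :
    Continuous (barrier α C : Euc (N + 1) → ℝ) := by
  unfold barrier
  have := continuous_yc (N := N)
  have h2 : Continuous fun X : Euc (N + 1) => yc X ^ (2 * α) :=
    this.rpow_const fun _ => Or.inr (by linarith)
  fun_prop

lemma exists_rpow_le {s q : ℝ} (hs : 0 ≤ s) (hsq : s < q) {δ : ℝ} (hδ : 0 < δ) :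
    ∃ K : ℝ, ∀ y : ℝ, 0 ≤ y → y ^ s ≤ δ * y ^ q + K := by
  obtain ⟨Y, hY⟩ := (((tendsto_rpow_atTop (sub_pos.2 hsq)).eventually_ge_atTop δ⁻¹).and
    (eventually_gt_atTop 0)).exists_forall_of_atTop
  refine ⟨|Y| ^ s, fun y hy => ?_⟩
  have hYs : 0 ≤ |Y| ^ s := by positivity
  rcases le_total Y y with h | h
  · obtain ⟨h1, h0⟩ := hY y h
    have h2 : y ^ q = y ^ (q - s) * y ^ s := by rw [← Real.rpow_add h0, sub_add_cancel]
    have h3 : 1 ≤ δ * y ^ (q - s) := by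
      calc 1 = δ * δ⁻¹ := (mul_inv_cancel₀ hδ.ne').symm
        _ ≤ _ := by gcongr
    have h4 : 0 ≤ y ^ s := by positivity
    rw [h2]
    nlinarith
  · have : y ^ s ≤ |Y| ^ s := Real.rpow_le_rpow hy (h.trans (le_abs_self Y)) hs
    have : 0 ≤ δ * y ^ q := by positivity
    linarith

lemma exists_barrier_ge (hα : α ∈ Ioo (0 : ℝ) 1) (ρ : ℝ) :
    ∃ C : ℝ, ∀ X : Euc (N + 1), ‖xc X‖ ≤ ρ → 0 ≤ yc X → yc X ^ 2 / 8 ≤ barrier α C X := by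
  obtain ⟨K, hK⟩ := exists_rpow_le (s := 2 * α) (q := 2) (δ := 1 / 8) (by linarith [hα.1])
    (by linarith [hα.2]) (by norm_num)
  refine ⟨ρ ^ 2 + K, fun X hX hy => ?_⟩
  have h1 := hK _ hy
  rw [Real.rpow_two] at h1
  have h2 : ‖xc X‖ ^ 2 ≤ ρ ^ 2 := by gcongr
  rw [barrier, norm_sq_eq]
  linarith

end Barrier

section MaximumPrinciple

variable {α : ℝ} {f : Euc (N + 1) → ℝ}

lemma isCompact_slab {G : Set (Euc N)} (hG : Bornology.IsBounded G) (a b : ℝ) :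
    IsCompact {X : Euc (N + 1) | xc X ∈ closure G ∧ yc X ∈ Icc a b} :=
  (splitHomeo N).isCompact_preimage.2 (hG.isCompact_closure.prod isCompact_Icc)

/-- Weak minimum principle for strict supersolutions on a finite cylinder. -/
lemma nonneg_of_strict_supersolution {G : Set (Euc N)} (hGo : IsOpen G)
    (hGb : Bornology.IsBounded G) {a b : ℝ}
    (hc : ContinuousOn f {X | xc X ∈ closure G ∧ yc X ∈ Icc a b})
    (hint : ∀ X, xc X ∈ G → yc X ∈ Ioo a b → ∃ l < 0, HasWLap α f X l)
    (hlat : ∀ x ∈ frontier G, ∀ y ∈ Icc a b, 0 ≤ f (pt x y))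
    (htop : ∀ x ∈ closure G, 0 ≤ f (pt x b))
    (hbot : ∀ x ∈ G, 0 ≤ f (pt x a) ∨ ∃ y ∈ Icc a b, f (pt x y) < f (pt x a))
    {X : Euc (N + 1)} (hX : xc X ∈ closure G) (hX' : yc X ∈ Icc a b) : 0 ≤ f X := by
  obtain ⟨Z, hZ, hmin⟩ := (isCompact_slab hGb a b).exists_isMinOn ⟨X, hX, hX'⟩ hc
  refine le_trans ?_ (hmin (show X ∈ _ from ⟨hX, hX'⟩))
  obtain ⟨hZ1, hZ2⟩ := hZ
  rw [← pt_xc_yc Z]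
  by_cases hZG : xc Z ∈ G
  swap
  · exact hlat _ (by rw [hGo.frontier_eq]; exact ⟨hZ1, hZG⟩) _ hZ2
  rcases hZ2.2.eq_or_lt with h | hb
  · rw [h]; exact htop _ hZ1
  rcases hZ2.1.eq_or_lt with h | ha
  · rcases hbot _ hZG with h' | ⟨y, hy, hlt⟩
    · rwa [← h]
    · have : f Z ≤ f (pt (xc Z) y) := hmin ⟨by simpa using hZ1, by simpa using hy⟩
      rw [h, pt_xc_yc] at hlt
      linarith
  · exfalso
    obtain ⟨l, hl, hL⟩ := hint Z hZG ⟨ha, hb⟩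
    have hopen : IsOpen {X : Euc (N + 1) | xc X ∈ G ∧ yc X ∈ Ioo a b} :=
      (hGo.prod isOpen_Ioo).preimage (splitHomeo N).continuous
    have hloc : IsLocalMin f Z := by
      filter_upwards [hopen.mem_nhds ⟨hZG, ha, hb⟩] with W hW
      exact hmin ⟨subset_closure hW.1, Ioo_subset_Icc_self hW.2⟩
    linarith [hL.nonneg_of_isLocalMin hloc]

end MaximumPrinciple

section SoftPositivePart

/-- A smooth convex approximation of the positive part. -/
def softPos (t : ℝ) : ℝ := ∫ s in (0 : ℝ)..t, Real.smoothTransition s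

lemma hasDerivAt_softPos (t : ℝ) : HasDerivAt softPos (Real.smoothTransition t) t :=
  intervalIntegral.integral_hasDerivAt_right
    (Real.smoothTransition.continuous.intervalIntegrable _ _)
    (Real.smoothTransition.continuous.stronglyMeasurableAtFilter _ _)
    Real.smoothTransition.continuous.continuousAt

lemma contDiff_softPos : ContDiff ℝ 2 softPos := by
  have h : deriv softPos = Real.smoothTransition := funext fun t => (hasDerivAt_softPos t).deriv
  rw [show (2 : WithTop ℕ∞) = 1 + 1 by norm_num, contDiff_succ_iff_deriv]
  refine ⟨fun t => (hasDerivAt_softPos t).differentiableAt, by simp, ?_⟩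
  rw [h]
  exact Real.smoothTransition.contDiff (n := 1)

lemma softPos_of_nonpos {t : ℝ} (ht : t ≤ 0) : softPos t = 0 := by
  rw [softPos, intervalIntegral.integral_symm, neg_eq_zero]
  refine intervalIntegral.integral_zero_ae (.of_forall fun s hs => ?_)
  rw [uIoc_of_le ht] at hs
  exact Real.smoothTransition.zero_of_nonpos hs.2

lemma monotone_softPos : Monotone softPos :=
  monotone_of_hasDerivAt_nonneg hasDerivAt_softPos fun t => Real.smoothTransition.nonneg t

lemma softPos_nonneg (t : ℝ) : 0 ≤ softPos t := by
  rcases le_total t 0 with h | h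
  · rw [softPos_of_nonpos h]
  · rw [← softPos_of_nonpos le_rfl]; exact monotone_softPos h

lemma sub_one_le_softPos (t : ℝ) : t - 1 ≤ softPos t := by
  rcases le_total t 1 with h | h
  · linarith [softPos_nonneg t]
  · have hm : MonotoneOn (fun t => softPos t - t) (Ici 1) := by
      refine monotoneOn_of_hasDerivWithinAt_nonneg (f' := fun _ => 0) (convex_Ici 1)
        ?_ (fun x hx => ?_) fun x hx => le_rfl
      · exact (contDiff_softPos.continuous.sub continuous_id).continuousOn
      · rw [interior_Ici] at hx
        have := (hasDerivAt_softPos x).sub (hasDerivAt_id x)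
        rw [Real.smoothTransition.one_of_one_le (le_of_lt hx), sub_self] at this
        exact this.hasDerivWithinAt
    have := hm (self_mem_Ici) (mem_Ici.2 h) h
    simp only at this
    linarith [softPos_nonneg 1]

lemma abs_softPos_sub_le (s t : ℝ) : |softPos s - softPos t| ≤ |s - t| := by
  have h : LipschitzWith 1 softPos := by
    refine lipschitzWith_of_nnnorm_deriv_le
      (fun t => (hasDerivAt_softPos t).differentiableAt) fun t => ?_
    rw [(hasDerivAt_softPos t).deriv, ← NNReal.coe_le_coe, coe_nnnorm,
      Real.norm_of_nonneg (Real.smoothTransition.nonneg t)]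
    exact Real.smoothTransition.le_one t
  simpa [Real.dist_eq] using h.dist_le_mul s t

end SoftPositivePart

section Composition

variable {α : ℝ} {f : Euc (N + 1) → ℝ} {X : Euc (N + 1)}

lemma HasWLap.comp_of_convex (hf : HasWLap α f X 0) {g g' : ℝ → ℝ} {c : ℝ}
    (hg : ∀ t, HasDerivAt g (g' t) t) (hg' : HasDerivAt g' c (f X)) (hc : 0 ≤ c) :
    ∃ l, 0 ≤ l ∧ HasWLap α (fun Z => g (f Z)) X l := by
  obtain ⟨d, s, h1, h2, h3⟩ := hf
  refine ⟨∑ i, c * d i X * d i X, Finset.sum_nonneg fun i _ => by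
      rw [mul_assoc]; exact mul_nonneg hc (mul_self_nonneg _),
    fun i Z => g' (f Z) * d i Z, fun i => c * d i X * d i X + g' (f X) * s i,
    fun i => ?_, fun i => ?_, ?_⟩
  · filter_upwards [h1 i] with Z hZ
    refine HasDerivAt.comp (0 : ℝ) (h₂ := g) ?_ hZ
    simpa using hg (f Z)
  · have e1 : HasLineDerivAt ℝ (fun Z => g' (f Z)) (c * d i X) X (EuclideanSpace.single i 1) := by
      refine HasDerivAt.comp (0 : ℝ) (h₂ := g') ?_ (h1 i).self_of_nhds
      simpa using hg'
    simpa [HasLineDerivAt] using HasDerivAt.fun_mul e1 (h2 i)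
  · rw [Finset.sum_add_distrib, ← Finset.mul_sum, add_assoc]
    have : (1 - 2 * α) / yc X * (g' (f X) * d (Fin.last N) X) =
      g' (f X) * ((1 - 2 * α) / yc X * d (Fin.last N) X) := by ring
    rw [this, ← mul_add, h3, mul_zero, add_zero]

end Composition

section HorizontalAverage

variable {h : Euc (N + 1) → ℝ} {X : Euc (N + 1)} {r : ℝ}

/-- Integral of `h` over horizontal translations by vectors of length at most `r`. -/
def hAvg (r : ℝ) (h : Euc (N + 1) → ℝ) (X : Euc (N + 1)) : ℝ :=
  ∫ ξ in closedBall (0 : Euc N) r, h (X - pt ξ 0)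

lemma yc_sub_pt (X : Euc (N + 1)) (ξ : Euc N) : yc (X - pt ξ 0) = yc X := by
  rw [sub_pt, yc_pt]

lemma continuous_sub_pt : Continuous fun q : Euc (N + 1) × Euc N => q.1 - pt q.2 0 :=
  continuous_fst.sub (continuous_pt.comp (continuous_snd.prodMk continuous_const))

lemma yc_pos_of_mem_closedBall (hX : 0 < yc X) {Z : Euc (N + 1)}
    (hZ : Z ∈ closedBall X (yc X / 2)) : 0 < yc Z := by
  have h1 : |yc Z - yc X| ≤ ‖Z - X‖ := by
    have := PiLp.norm_apply_le (Z - X) (Fin.last N)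
    simpa [yc] using this
  rw [mem_closedBall, dist_eq_norm] at hZ
  linarith [(abs_le.1 (h1.trans hZ)).1]

lemma exists_bound_translates (hh : ∀ Z, 0 < yc Z → ContinuousAt h Z) (hX : 0 < yc X) (r : ℝ) :
    ∃ M : ℝ, ∀ Z ∈ closedBall X (yc X / 2), ∀ ξ ∈ closedBall (0 : Euc N) r,
      ‖h (Z - pt ξ 0)‖ ≤ M := by
  have hK : IsCompact (closedBall X (yc X / 2) ×ˢ closedBall (0 : Euc N) r) :=
    (isCompact_closedBall _ _).prod (isCompact_closedBall _ _)
  have hc : ContinuousOn (fun q : Euc (N + 1) × Euc N => h (q.1 - pt q.2 0))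
      (closedBall X (yc X / 2) ×ˢ closedBall (0 : Euc N) r) := fun q hq =>
    (ContinuousAt.comp (f := fun q : Euc (N + 1) × Euc N => q.1 - pt q.2 0)
      (hh _ (by rw [yc_sub_pt]; exact yc_pos_of_mem_closedBall hX hq.1))
      continuous_sub_pt.continuousAt).continuousWithinAt
  obtain ⟨M, hM⟩ := hK.exists_bound_of_continuousOn hc
  exact ⟨M, fun Z hZ ξ hξ => hM (Z, ξ) ⟨hZ, hξ⟩⟩

lemma continuous_translate (hh : ∀ Z, 0 < yc Z → ContinuousAt h Z) (hX : 0 < yc X) :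
    Continuous fun ξ : Euc N => h (X - pt ξ 0) :=
  continuous_iff_continuousAt.2 fun ξ =>
    ContinuousAt.comp (f := fun ξ : Euc N => X - pt ξ 0) (hh _ (by rwa [yc_sub_pt]))
      (continuous_sub_pt.comp (continuous_const.prodMk continuous_id)).continuousAt

lemma integrableOn_translate (hh : ∀ Z, 0 < yc Z → ContinuousAt h Z) (hX : 0 < yc X) :
    IntegrableOn (fun ξ : Euc N => h (X - pt ξ 0)) (closedBall 0 r) :=
  (continuous_translate hh hX).continuousOn.integrableOn_compact (isCompact_closedBall _ _)

lemma integrableOn_const_closedBall (M : ℝ) :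
    IntegrableOn (fun _ : Euc N => M) (closedBall 0 r) :=
  continuousOn_const.integrableOn_compact (isCompact_closedBall _ _)

lemma continuousAt_hAvg (hh : ∀ Z, 0 < yc Z → ContinuousAt h Z) (hX : 0 < yc X) :
    ContinuousAt (hAvg r h) X := by
  obtain ⟨M, hM⟩ := exists_bound_translates hh hX r
  have hball : closedBall X (yc X / 2) ∈ 𝓝 X := closedBall_mem_nhds _ (by linarith)
  refine continuousAt_of_dominated (bound := fun _ => M) ?_ ?_ (integrableOn_const_closedBall M) ?_
  · filter_upwards [hball] with Z hZ
    exact (continuous_translate hh (yc_pos_of_mem_closedBall hX hZ)).aestronglyMeasurable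
  · filter_upwards [hball] with Z hZ
    exact (ae_restrict_mem measurableSet_closedBall).mono fun ξ hξ => hM Z hZ ξ hξ
  · refine .of_forall fun ξ => ?_
    exact ContinuousAt.comp (f := fun Z => Z - pt ξ 0) (hh _ (by rwa [yc_sub_pt]))
      (continuous_sub_pt.comp (continuous_id.prodMk continuous_const)).continuousAt

lemma continuousAt_fderiv_apply (hh : ContDiffAt ℝ 1 h X) (e : Euc (N + 1)) :
    ContinuousAt (fun Z => fderiv ℝ h Z e) X :=
  ((hh.fderiv_right (m := 0) (by norm_num)).continuousAt).clm_apply continuousAt_const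

lemma hasLineDerivAt_hAvg (hh : ∀ Z, 0 < yc Z → ContDiffAt ℝ 1 h Z) (hX : 0 < yc X)
    (i : Fin (N + 1)) :
    HasLineDerivAt ℝ (hAvg r h) (hAvg r (fun Z => fderiv ℝ h Z (EuclideanSpace.single i 1)) X) X
      (EuclideanSpace.single i 1) := by
  set e : Euc (N + 1) := EuclideanSpace.single i 1 with he
  have hc : ∀ Z, 0 < yc Z → ContinuousAt h Z := fun Z hZ => (hh Z hZ).continuousAt
  have hc' : ∀ Z, 0 < yc Z → ContinuousAt (fun Z => fderiv ℝ h Z e) Z :=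
    fun Z hZ => continuousAt_fderiv_apply (hh Z hZ) e
  obtain ⟨M, hM⟩ := exists_bound_translates hc' hX r
  have hball : ∀ t ∈ closedBall (0 : ℝ) (yc X / 2), X + t • e ∈ closedBall X (yc X / 2) := by
    intro t ht
    simpa [mem_closedBall, dist_eq_norm, he, norm_smul] using ht
  have hnhds : closedBall (0 : ℝ) (yc X / 2) ∈ 𝓝 0 := closedBall_mem_nhds _ (by linarith)
  have key := hasDerivAt_integral_of_dominated_loc_of_deriv_le
    (μ := volume.restrict (closedBall (0 : Euc N) r)) (F := fun t ξ => h (X + t • e - pt ξ 0))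
    (F' := fun t ξ => fderiv ℝ h (X + t • e - pt ξ 0) e) (bound := fun _ => M) hnhds
    (by
      filter_upwards [hnhds] with t ht
      exact (continuous_translate hc
        (yc_pos_of_mem_closedBall hX (hball t ht))).aestronglyMeasurable)
    (by simp only [zero_smul, add_zero]; exact integrableOn_translate hc hX)
    (by simpa using (continuous_translate hc' hX).aestronglyMeasurable)
    ((ae_restrict_mem measurableSet_closedBall).mono fun ξ hξ t ht => hM _ (hball t ht) ξ hξ)
    (integrableOn_const_closedBall M)
    (.of_forall fun ξ t ht => by
      have hpos : 0 < yc (X + t • e - pt ξ 0) := by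
        rw [yc_sub_pt]; exact yc_pos_of_mem_closedBall hX (hball t ht)
      have h1 : HasDerivAt (fun t : ℝ => X + t • e - pt ξ 0) e t := by
        simpa using (((hasDerivAt_id t).smul_const e).const_add X).sub_const (pt ξ 0)
      exact (((hh _ hpos).differentiableAt (by simp)).hasFDerivAt).comp_hasDerivAt t h1)
  simpa [HasLineDerivAt, hAvg] using key.2

lemma hasWLap_hAvg {α : ℝ} (hh : ∀ Z, 0 < yc Z → ContDiffAt ℝ 2 h Z) (hX : 0 < yc X) :
    HasWLap α (hAvg r h) X (hAvg r (wLap α h) X) := by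
  have h1 : ∀ Z, 0 < yc Z → ContDiffAt ℝ 1 h Z := fun Z hZ => (hh Z hZ).of_le (by norm_num)
  have h2 : ∀ i, ∀ Z, 0 < yc Z →
      ContDiffAt ℝ 1 (fun Z => fderiv ℝ h Z (EuclideanSpace.single i 1)) Z :=
    fun i Z hZ => contDiffAt_fderiv_apply (hh Z hZ) _
  refine ⟨fun i => hAvg r fun Z => fderiv ℝ h Z (EuclideanSpace.single i 1), _, fun i => ?_,
    fun i => hasLineDerivAt_hAvg (h2 i) hX i, ?_⟩
  · filter_upwards [isOpen_upperHalf.mem_nhds hX] with Z hZ using hasLineDerivAt_hAvg h1 hZ i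
  · simp only [hAvg, wLap, yc_sub_pt]
    rw [integral_add, integral_finsetSum, integral_const_mul]
    · exact fun i _ => integrableOn_translate
        (fun Z hZ => continuousAt_fderiv_apply (h2 i Z hZ) _) hX
    · exact integrable_finsetSum _ fun i _ => integrableOn_translate
        (fun Z hZ => continuousAt_fderiv_apply (h2 i Z hZ) _) hX
    · exact (integrableOn_translate
        (fun Z hZ => continuousAt_fderiv_apply (h1 Z hZ) _) hX).const_mul _

end HorizontalAverage

section Truncation

variable {α : ℝ} {Ω : Set (Euc N)} {z : Euc (N + 1) → ℝ} {X : Euc (N + 1)}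

/-- A finite-energy solution on `C_Ω` with nonnegative lateral values and nonnegative
flux through the base. -/
structure NonnegData (α : ℝ) (Ω : Set (Euc N)) (z : Euc (N + 1) → ℝ) : Prop where
  cont : ContinuousOn z (closure (cyl Ω))
  smooth : ContDiffOn ℝ 2 z (cyl Ω)
  energy : IntegrableOn (eDen α z) (cyl Ω)
  pde : ∀ X ∈ cyl Ω, HasWLap α z X 0
  lateral : ∀ x ∈ frontier Ω, ∀ y : ℝ, 0 < y → 0 ≤ z (pt x y)
  neumann : ∀ x ∈ Ω, ∃ L ≤ 0, NeumannLim α z x L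

/-- A smooth version of the positive part of `-z - 1`, extended by zero off `C_Ω`. -/
def negTrunc (Ω : Set (Euc N)) (z : Euc (N + 1) → ℝ) : Euc (N + 1) → ℝ :=
  (cyl Ω).indicator fun Z => softPos (-z Z - 1)

lemma negTrunc_nonneg (X : Euc (N + 1)) : 0 ≤ negTrunc Ω z X :=
  indicator_nonneg (fun _ _ => softPos_nonneg _) X

lemma negTrunc_of_notMem (hX : xc X ∉ Ω) : negTrunc Ω z X = 0 :=
  indicator_of_notMem (fun h => hX h.1) _

lemma negTrunc_of_mem (hX : X ∈ cyl Ω) : negTrunc Ω z X = softPos (-z X - 1) :=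
  indicator_of_mem hX _

lemma neg_sub_two_le_negTrunc (hX : X ∈ cyl Ω) : -z X - 2 ≤ negTrunc Ω z X := by
  rw [negTrunc_of_mem hX]
  linarith [sub_one_le_softPos (-z X - 1)]

lemma NonnegData.negTrunc_eventuallyEq_zero (hz : NonnegData α Ω z) (hΩo : IsOpen Ω)
    (hX : 0 < yc X) (hXΩ : X ∉ cyl Ω) : negTrunc Ω z =ᶠ[𝓝 X] fun _ => 0 := by
  by_cases hcl : X ∈ closure (cyl Ω)
  · have hfr : xc X ∈ frontier Ω := by
      rw [hΩo.frontier_eq]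
      exact ⟨(mem_closure_cyl.1 hcl).1, fun h => hXΩ ⟨h, hX⟩⟩
    have h0 : 0 ≤ z X := by simpa using hz.lateral _ hfr _ hX
    have h1 : ∀ᶠ Z in 𝓝[closure (cyl Ω)] X, -1 < z Z :=
      (hz.cont X hcl).eventually (lt_mem_nhds (by linarith))
    filter_upwards [eventually_nhdsWithin_iff.1 h1] with Z hZ
    by_cases hZΩ : Z ∈ cyl Ω
    · rw [negTrunc_of_mem hZΩ]
      exact softPos_of_nonpos (by linarith [hZ (subset_closure hZΩ)])
    · exact indicator_of_notMem hZΩ _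
  · filter_upwards [isClosed_closure.isOpen_compl.mem_nhds hcl] with Z hZ
    exact indicator_of_notMem (fun h => hZ (subset_closure h)) _

lemma negTrunc_eventuallyEq (hΩo : IsOpen Ω) (hX : X ∈ cyl Ω) :
    negTrunc Ω z =ᶠ[𝓝 X] fun Z => softPos (-1 * z Z + -1) := by
  filter_upwards [(isOpen_cyl hΩo).mem_nhds hX] with Z hZ
  rw [negTrunc_of_mem hZ]
  congr 1
  ring

lemma NonnegData.contDiffAt (hz : NonnegData α Ω z) (hΩo : IsOpen Ω) (hX : X ∈ cyl Ω) :
    ContDiffAt ℝ 2 z X :=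
  hz.smooth.contDiffAt ((isOpen_cyl hΩo).mem_nhds hX)

lemma NonnegData.contDiffAt_negTrunc (hz : NonnegData α Ω z) (hΩo : IsOpen Ω)
    (hX : 0 < yc X) : ContDiffAt ℝ 2 (negTrunc Ω z) X := by
  by_cases h : X ∈ cyl Ω
  · refine ContDiffAt.congr_of_eventuallyEq ?_ (negTrunc_eventuallyEq hΩo h)
    exact contDiff_softPos.contDiffAt.comp X
      ((contDiffAt_const.mul (hz.contDiffAt hΩo h)).add contDiffAt_const)
  · exact contDiffAt_const.congr_of_eventuallyEq (hz.negTrunc_eventuallyEq_zero hΩo hX h)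

lemma NonnegData.wLap_negTrunc_nonneg (hz : NonnegData α Ω z) (hΩo : IsOpen Ω)
    (hX : 0 < yc X) : 0 ≤ wLap α (negTrunc Ω z) X := by
  have hu := hasWLap_wLap (α := α) (hz.contDiffAt_negTrunc hΩo hX)
  by_cases h : X ∈ cyl Ω
  · have h1 : HasWLap α (fun Z => -1 * z Z + -1) X 0 := by
      simpa using ((hz.pde X h).const_mul (-1)).add (hasWLap_const (α := α) (X := X) (-1))
    have h2 : HasDerivAt Real.smoothTransition
        (deriv Real.smoothTransition (-1 * z X + -1)) (-1 * z X + -1) :=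
      (Real.smoothTransition.contDiff (n := 1)).differentiable (by simp) _ |>.hasDerivAt
    obtain ⟨l, hl, hL⟩ := h1.comp_of_convex hasDerivAt_softPos h2
      Real.smoothTransition.monotone.deriv_nonneg
    rwa [hu.unique (hL.congr (negTrunc_eventuallyEq hΩo h))]
  · rw [hu.unique ((hasWLap_const 0).congr (hz.negTrunc_eventuallyEq_zero hΩo hX h))]

lemma NonnegData.continuousAt_negTrunc (hz : NonnegData α Ω z) (hΩo : IsOpen Ω) :
    ∀ Z, 0 < yc Z → ContinuousAt (negTrunc Ω z) Z :=
  fun _ hZ => (hz.contDiffAt_negTrunc hΩo hZ).continuousAt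

lemma NonnegData.continuous_negTrunc_slice (hz : NonnegData α Ω z) (hΩo : IsOpen Ω)
    {y : ℝ} (hy : 0 < y) : Continuous fun x => negTrunc Ω z (pt x y) :=
  continuous_iff_continuousAt.2 fun x =>
    ContinuousAt.comp (f := fun x => pt x y) (hz.continuousAt_negTrunc hΩo _ (by simpa))
      (continuous_pt.comp (continuous_id.prodMk continuous_const)).continuousAt

lemma NonnegData.integrable_negTrunc_slice (hz : NonnegData α Ω z) (hΩo : IsOpen Ω)
    (hΩb : Bornology.IsBounded Ω) {y : ℝ} (hy : 0 < y) :
    Integrable fun x => negTrunc Ω z (pt x y) := by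
  refine (hz.continuous_negTrunc_slice hΩo hy).integrable_of_hasCompactSupport ?_
  refine HasCompactSupport.intro hΩb.isCompact_closure fun x hx => ?_
  exact negTrunc_of_notMem (by simpa using fun h => hx (subset_closure h))

lemma NonnegData.hAvg_le (hz : NonnegData α Ω z) (hΩo : IsOpen Ω)
    (hΩb : Bornology.IsBounded Ω) (hX : 0 < yc X) (r : ℝ) :
    hAvg r (negTrunc Ω z) X ≤ ∫ x in Ω, negTrunc Ω z (pt x (yc X)) := by
  have hi := hz.integrable_negTrunc_slice hΩo hΩb hX
  have hi' : Integrable fun ξ => negTrunc Ω z (pt (xc X - ξ) (yc X)) :=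
    hi.comp_sub_left (xc X)
  calc hAvg r (negTrunc Ω z) X
      = ∫ ξ in closedBall 0 r, negTrunc Ω z (pt (xc X - ξ) (yc X)) := by simp only [hAvg, sub_pt]
    _ ≤ ∫ ξ, negTrunc Ω z (pt (xc X - ξ) (yc X)) :=
        setIntegral_le_integral hi' (.of_forall fun _ => negTrunc_nonneg _)
    _ = ∫ x, negTrunc Ω z (pt x (yc X)) :=
        integral_sub_left_eq_self (fun x => negTrunc Ω z (pt x (yc X))) volume (xc X)
    _ = _ := (setIntegral_eq_integral_of_forall_compl_eq_zero fun x hx =>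
        negTrunc_of_notMem (by simpa using hx)).symm

end Truncation

section SliceBound

variable {α : ℝ} {Ω : Set (Euc N)} {z : Euc (N + 1) → ℝ} {X : Euc (N + 1)}

lemma softPos_le_add {s t c : ℝ} (hc : 0 ≤ c) (h : s ≤ t + c) : softPos s ≤ softPos t + c := by
  have h1 := monotone_softPos h
  have h2 := abs_softPos_sub_le (t + c) t
  rw [add_sub_cancel_left, abs_of_nonneg hc] at h2
  linarith [(abs_le.1 h2).2]

lemma abs_fderiv_le_eDen (hX : 0 < yc X) :
    |fderiv ℝ z X (EuclideanSpace.single (Fin.last N) 1)| ≤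
      eDen α z X + yc X ^ (2 * α - 1) := by
  have h1 : |fderiv ℝ z X (EuclideanSpace.single (Fin.last N) 1)| ≤ ‖gradient z X‖ := by
    rw [← gradient_apply]
    exact PiLp.norm_apply_le (gradient z X) (Fin.last N)
  have h2 : 0 < yc X ^ (1 - 2 * α) := Real.rpow_pos_of_pos hX _
  have h3 : yc X ^ (2 * α - 1) = (yc X ^ (1 - 2 * α))⁻¹ := by
    rw [← Real.rpow_neg hX.le]; congr 1; ring
  refine h1.trans ?_
  rw [eDen, h3]
  set P := yc X ^ (1 - 2 * α)
  set t := ‖gradient z X‖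
  have h4 : P * t ^ 2 + P⁻¹ - t = P * (t - P⁻¹ / 2) ^ 2 + 3 / 4 * P⁻¹ := by
    field_simp
    ring
  have : 0 ≤ P * (t - P⁻¹ / 2) ^ 2 + 3 / 4 * P⁻¹ := by positivity
  linarith

lemma eDen_nonneg (hX : 0 ≤ yc X) : 0 ≤ eDen α z X := by
  unfold eDen
  positivity

lemma continuousOn_eDen (hΩo : IsOpen Ω) (hz : ContDiffOn ℝ 2 z (cyl Ω)) :
    ContinuousOn (eDen α z) (cyl Ω) := by
  have h1 : ContinuousOn (fun X : Euc (N + 1) => yc X ^ (1 - 2 * α)) (cyl Ω) :=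
    continuous_yc.continuousOn.rpow_const fun X hX => Or.inl hX.2.ne'
  have h2 : ContinuousOn (fderiv ℝ z) (cyl Ω) :=
    hz.continuousOn_fderiv_of_isOpen (isOpen_cyl hΩo) (by norm_num)
  have h3 : ContinuousOn (gradient z) (cyl Ω) :=
    (InnerProductSpace.toDual ℝ (Euc (N + 1))).symm.continuous.comp_continuousOn h2
  exact h1.mul (h3.norm.pow 2)

lemma NonnegData.hasDerivAt_vertical (hz : NonnegData α Ω z) (hΩo : IsOpen Ω) {x : Euc N}
    (hx : x ∈ Ω) {y : ℝ} (hy : 0 < y) : HasDerivAt (fun t => z (pt x t))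
      (fderiv ℝ z (pt x y) (EuclideanSpace.single (Fin.last N) 1)) y :=
  ((hz.contDiffAt hΩo ⟨by simpa, by simpa⟩).differentiableAt
    (by simp)).hasFDerivAt.comp_hasDerivAt y (hasDerivAt_pt x y)

lemma NonnegData.integrable_eDen_prod (hz : NonnegData α Ω z) :
    Integrable (fun q : Euc N × ℝ => eDen α z (pt q.1 q.2))
      ((volume.restrict Ω).prod (volume.restrict (Ioi 0))) := by
  have h := (measurePreserving_splitHomeo N).integrableOn_comp_preimage
    (splitHomeo N).measurableEmbedding (f := fun q => eDen α z (pt q.1 q.2)) (s := Ω ×ˢ Ioi 0)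
  rw [← cyl_eq_preimage] at h
  have h' : (fun q : Euc N × ℝ => eDen α z (pt q.1 q.2)) ∘ splitHomeo N = eDen α z := by
    funext X
    simp [splitHomeo]
  rw [h'] at h
  rw [Measure.prod_restrict]
  exact h.1 hz.energy

lemma NonnegData.negTrunc_le_add (hz : NonnegData α Ω z) (hΩo : IsOpen Ω) (hα : 0 < α)
    {x : Euc N} (hx : x ∈ Ω)
    (hE : IntegrableOn (fun s => eDen α z (pt x s)) (Ioi 0)) {y : ℝ} (hy : 1 ≤ y) :
    negTrunc Ω z (pt x y) ≤ negTrunc Ω z (pt x 1) +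
      ((∫ s in Ioi 0, eDen α z (pt x s)) + y ^ (2 * α) / (2 * α)) := by
  have hmem : ∀ s : ℝ, 0 < s → pt x s ∈ cyl Ω := fun s hs => ⟨by simpa, by simpa⟩
  have hEc : ContinuousOn (fun s => eDen α z (pt x s)) (Icc 1 y) :=
    (continuousOn_eDen hΩo hz.smooth).comp
      (continuous_pt.comp (continuous_const.prodMk continuous_id)).continuousOn
      fun s hs => hmem s (by linarith [hs.1])
  have hPc : ContinuousOn (fun s : ℝ => s ^ (2 * α - 1)) (Icc 1 y) :=
    continuousOn_id.rpow_const fun s hs => Or.inl (by simp; linarith [hs.1])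
  have hd : ∀ s ∈ Icc 1 y, HasDerivAt (fun t => -z (pt x t))
      (-fderiv ℝ z (pt x s) (EuclideanSpace.single (Fin.last N) 1)) s := fun s hs =>
    (hz.hasDerivAt_vertical hΩo hx (by linarith [hs.1])).neg
  have key := intervalIntegral.sub_le_integral_of_hasDeriv_right_of_le hy
    (fun s hs => (hd s hs).continuousAt.continuousWithinAt)
    (fun s hs => (hd s (Ioo_subset_Icc_self hs)).hasDerivWithinAt)
    ((hEc.add hPc).integrableOn_Icc)
    (fun s hs => by
      have := abs_fderiv_le_eDen (α := α) (z := z) (X := pt x s) (by simp; linarith [hs.1])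
      rw [yc_pt] at this
      simpa using (neg_le_abs _).trans this)
  simp only [Pi.add_apply] at key
  have hEi : IntervalIntegrable (fun s => eDen α z (pt x s)) volume 1 y := by
    apply ContinuousOn.intervalIntegrable; rwa [uIcc_of_le hy]
  have hPi : IntervalIntegrable (fun s : ℝ => s ^ (2 * α - 1)) volume 1 y := by
    apply ContinuousOn.intervalIntegrable; rwa [uIcc_of_le hy]
  rw [intervalIntegral.integral_add hEi hPi, integral_rpow (Or.inl (by linarith)),
    sub_add_cancel, Real.one_rpow] at key
  have h1 : ∫ s in 1..y, eDen α z (pt x s) ≤ ∫ s in Ioi 0, eDen α z (pt x s) := by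
    rw [intervalIntegral.integral_of_le hy]
    refine setIntegral_mono_set hE ?_ (LE.le.eventuallyLE fun s hs => ?_)
    · exact (ae_restrict_mem measurableSet_Ioi).mono fun s hs =>
        eDen_nonneg (by simpa using le_of_lt hs)
    · exact lt_trans zero_lt_one hs.1
  have h2 : 0 ≤ ∫ s in Ioi 0, eDen α z (pt x s) :=
    setIntegral_nonneg measurableSet_Ioi fun s hs => eDen_nonneg (by simpa using le_of_lt hs)
  have h3 : (y ^ (2 * α) - 1) / (2 * α) ≤ y ^ (2 * α) / (2 * α) := by gcongr; linarith
  have h4 : 0 ≤ y ^ (2 * α) / (2 * α) := by positivity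
  rw [negTrunc_of_mem (hmem y (by linarith)), negTrunc_of_mem (hmem 1 one_pos)]
  exact softPos_le_add (by linarith) (by linarith)

lemma NonnegData.exists_slice_bound (hz : NonnegData α Ω z) (hΩo : IsOpen Ω)
    (hΩb : Bornology.IsBounded Ω) (hα : 0 < α) :
    ∃ H₁ H₂ : ℝ, 0 ≤ H₂ ∧
      ∀ y, 1 ≤ y → ∫ x in Ω, negTrunc Ω z (pt x y) ≤ H₁ + H₂ * y ^ (2 * α) := by
  have hI := hz.integrable_eDen_prod
  have hI1 : IntegrableOn (fun x => ∫ s in Ioi 0, eDen α z (pt x s)) Ω := hI.integral_prod_left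
  have hI2 : ∀ᵐ x ∂volume.restrict Ω, IntegrableOn (fun s => eDen α z (pt x s)) (Ioi 0) :=
    hI.prod_right_ae
  have hu : ∀ y : ℝ, 0 < y → IntegrableOn (fun x => negTrunc Ω z (pt x y)) Ω := fun y hy =>
    (hz.integrable_negTrunc_slice hΩo hΩb hy).integrableOn
  have hcst : ∀ c : ℝ, IntegrableOn (fun _ : Euc N => c) Ω := fun c =>
    (continuousOn_const.integrableOn_compact hΩb.isCompact_closure).mono_set subset_closure
  have hsum : ∀ c : ℝ, IntegrableOn (fun x => (∫ s in Ioi 0, eDen α z (pt x s)) + c) Ω :=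
    fun c => hI1.add (hcst c)
  refine ⟨(∫ x in Ω, negTrunc Ω z (pt x 1)) + ∫ x in Ω, ∫ s in Ioi 0, eDen α z (pt x s),
    volume.real Ω / (2 * α), by positivity, fun y hy => ?_⟩
  calc ∫ x in Ω, negTrunc Ω z (pt x y)
      ≤ ∫ x in Ω, (negTrunc Ω z (pt x 1) +
          ((∫ s in Ioi 0, eDen α z (pt x s)) + y ^ (2 * α) / (2 * α))) := by
        refine integral_mono_ae (hu y (by linarith)) ((hu 1 one_pos).add (hsum _)) ?_
        filter_upwards [hI2, ae_restrict_mem hΩo.measurableSet] with x hx hxΩ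
        exact hz.negTrunc_le_add hΩo hα hxΩ hx hy
    _ = _ := by
        rw [integral_add (hu 1 one_pos) (hsum _), integral_add hI1 (hcst _)]
        simp only [setIntegral_const, smul_eq_mul]
        ring

end SliceBound

section LowerBound

variable {α : ℝ} {Ω : Set (Euc N)} {z : Euc (N + 1) → ℝ} {X : Euc (N + 1)}

lemma le_of_forall_le_add_mul {a b c : ℝ} (h : ∀ ε > 0, a ≤ b + ε * c) : a ≤ b := by
  have h1 : Tendsto (fun ε : ℝ => b + ε * c) (𝓝[>] 0) (𝓝 (b + 0 * c)) :=
    ((continuous_const.add (continuous_id.mul continuous_const)).tendsto _).mono_left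
      nhdsWithin_le_nhds
  rw [zero_mul, add_zero] at h1
  exact ge_of_tendsto h1 (eventually_mem_nhdsWithin.mono h)

lemma exists_quadratic_dominates (hα : α ∈ Ioo (0 : ℝ) 1) {ε : ℝ} (hε : 0 < ε) (H₁ : ℝ) {H₂ : ℝ}
    (hH₂ : 0 ≤ H₂) (R₀ : ℝ) : ∃ R, R₀ ≤ R ∧ 1 ≤ R ∧ H₁ + H₂ * R ^ (2 * α) ≤ ε * (R ^ 2 / 8) := by
  obtain ⟨K, hK⟩ := exists_rpow_le (s := 2 * α) (q := 2) (δ := ε / (16 * (H₂ + 1)))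
    (by linarith [hα.1]) (by linarith [hα.2]) (by positivity)
  have ht : Tendsto (fun R : ℝ => ε / 16 * R ^ 2) atTop atTop :=
    (tendsto_pow_atTop two_ne_zero).const_mul_atTop (by positivity)
  obtain ⟨R, ⟨h1, h2⟩, h3⟩ := (((eventually_ge_atTop R₀).and (eventually_ge_atTop 1)).and
    (ht.eventually_ge_atTop (H₁ + H₂ * K))).exists
  refine ⟨R, h1, h2, ?_⟩
  have h4 := mul_le_mul_of_nonneg_left (hK R (by linarith)) hH₂
  rw [Real.rpow_two] at h4
  have h5 : H₂ * (ε / (16 * (H₂ + 1))) ≤ ε / 16 := by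
    rw [mul_div_assoc', div_le_div_iff₀ (by positivity) (by norm_num)]
    nlinarith
  have h6 := mul_le_mul_of_nonneg_right h5 (sq_nonneg R)
  nlinarith

lemma barrier_wLap_neg (hN : 1 ≤ N) (hα : 0 < α) {ε : ℝ} (hε : 0 < ε) :
    ε * (-2 * (N : ℝ) + (1 - α)) < 0 := by
  have : (1 : ℝ) ≤ N := by exact_mod_cast hN
  exact mul_neg_of_pos_of_neg hε (by linarith)

lemma setIntegral_closedBall_le {g : Euc N → ℝ} {r K : ℝ} (hg : IntegrableOn g (closedBall 0 r))
    (h : ∀ ξ, g ξ ≤ K) : ∫ ξ in closedBall 0 r, g ξ ≤ volume.real (closedBall (0 : Euc N) r) * K := by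
  calc _ ≤ ∫ _ in closedBall (0 : Euc N) r, K :=
        setIntegral_mono_on hg (integrableOn_const_closedBall K) measurableSet_closedBall
          fun ξ _ => h ξ
    _ = _ := by rw [setIntegral_const, smul_eq_mul]

lemma le_setIntegral_closedBall {g : Euc N → ℝ} {r K : ℝ} (hg : IntegrableOn g (closedBall 0 r))
    (h : ∀ ξ ∈ closedBall 0 r, K ≤ g ξ) :
    volume.real (closedBall (0 : Euc N) r) * K ≤ ∫ ξ in closedBall 0 r, g ξ := by
  calc _ = ∫ _ in closedBall (0 : Euc N) r, K := by rw [setIntegral_const, smul_eq_mul]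
    _ ≤ _ := setIntegral_mono_on (integrableOn_const_closedBall K) hg measurableSet_closedBall h

lemma NonnegData.hAvg_le_mul (hz : NonnegData α Ω z) (hΩo : IsOpen Ω)
    (hΩb : Bornology.IsBounded Ω) (hN : 1 ≤ N) (hα : α ∈ Ioo (0 : ℝ) 1) {K : ℝ} (hK0 : 0 ≤ K)
    (hK : ∀ x, negTrunc Ω z (pt x 1) ≤ K) {r : ℝ} (hr : r ≤ 1)
    (hX : xc X ∈ Ω) (hX' : 1 ≤ yc X) :
    hAvg r (negTrunc Ω z) X ≤ volume.real (closedBall (0 : Euc N) r) * K := by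
  obtain ⟨ρ, hρ0, hρ⟩ := hΩb.subset_ball_lt 0 0
  obtain ⟨C, hC⟩ := exists_barrier_ge (N := N) hα (ρ + 1)
  obtain ⟨H₁, H₂, hH₂, hH⟩ := hz.exists_slice_bound hΩo hΩb hα.1
  set u := negTrunc Ω z with hu
  set V := volume.real (closedBall (0 : Euc N) r) with hV
  have hV0 : 0 ≤ V := measureReal_nonneg
  have huc := hz.continuousAt_negTrunc hΩo
  refine le_of_forall_le_add_mul (c := barrier α C X) fun ε hε => ?_
  obtain ⟨R, hXR, hR1, hR⟩ := exists_quadratic_dominates hα hε H₁ hH₂ (yc X)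
  have hnorm : ∀ x ∈ closure (ball (0 : Euc N) (ρ + 1)), ‖x‖ ≤ ρ + 1 := fun x hx => by
    simpa using closure_ball_subset_closedBall hx
  have hbar : ∀ x ∈ closure (ball (0 : Euc N) (ρ + 1)), ∀ y, 0 ≤ y →
      ε * (y ^ 2 / 8) ≤ ε * barrier α C (pt x y) := fun x hx y hy => by
    have := hC (pt x y) (by simpa using hnorm x hx) (by simpa)
    rw [yc_pt] at this
    gcongr
  have hVK : 0 ≤ V * K := mul_nonneg hV0 hK0
  suffices 0 ≤ (V * K + ε * barrier α C X) + -1 * hAvg r u X by linarith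
  refine nonneg_of_strict_supersolution (α := α)
    (f := fun Z => (V * K + ε * barrier α C Z) + -1 * hAvg r u Z)
    (G := ball (0 : Euc N) (ρ + 1)) isOpen_ball isBounded_ball (a := 1) (b := R)
    ?_ ?_ ?_ ?_ ?_ (subset_closure (ball_subset_ball (by linarith) (hρ hX))) ⟨hX', hXR⟩
  · intro Z hZ
    have h0 : 0 < yc Z := by linarith [hZ.2.1]
    exact ((continuousAt_const.add (continuousAt_const.mul
      (continuous_barrier hα.1 C).continuousAt)).add
      (continuousAt_const.mul (continuousAt_hAvg huc h0))).continuousWithinAt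
  · intro Z _ hZ
    have h0 : 0 < yc Z := by linarith [hZ.1]
    refine ⟨_, ?_, ((hasWLap_const _).add ((hasWLap_barrier C h0).const_mul ε)).add
      ((hasWLap_hAvg (fun Z hZ => hz.contDiffAt_negTrunc hΩo hZ) h0).const_mul (-1))⟩
    have h1 : 0 ≤ hAvg r (wLap α u) Z := setIntegral_nonneg measurableSet_closedBall
      fun ξ _ => hz.wLap_negTrunc_nonneg hΩo (by rwa [yc_sub_pt])
    linarith [barrier_wLap_neg hN hα.1 hε]
  · intro x hx y hy
    have h1 : ‖x‖ = ρ + 1 := by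
      rw [frontier_ball _ (by linarith)] at hx
      simpa using hx
    have h2 : hAvg r u (pt x y) = 0 := by
      refine setIntegral_eq_zero_of_forall_eq_zero fun ξ hξ => negTrunc_of_notMem fun h => ?_
      rw [sub_pt, xc_pt, xc_pt] at h
      have h3 : ‖x - ξ‖ < ρ := by simpa using hρ h
      have h4 : ‖ξ‖ ≤ r := by simpa using hξ
      have h5 := norm_sub_norm_le x ξ
      linarith
    have h3 := hbar x (frontier_subset_closure hx) y (by linarith [hy.1])
    have h4 : 0 ≤ ε * (y ^ 2 / 8) := by positivity
    simp only [h2]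
    linarith
  · intro x hx
    have h1 := hz.hAvg_le hΩo hΩb (X := pt x R) (by simp; linarith) r
    rw [yc_pt] at h1
    linarith [hH R hR1, hbar x hx R (by linarith)]
  · intro x hx
    left
    have h1 : hAvg r u (pt x 1) ≤ V * K := setIntegral_closedBall_le
      (integrableOn_translate huc (by simp)) fun ξ => by
        rw [sub_pt, yc_pt, xc_pt]; exact hK _
    have h2 := hbar x (subset_closure hx) 1 zero_le_one
    have h3 : 0 ≤ ε * (1 ^ 2 / 8) := by positivity
    linarith

lemma NonnegData.negTrunc_le (hz : NonnegData α Ω z) (hΩo : IsOpen Ω)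
    (hΩb : Bornology.IsBounded Ω) (hN : 1 ≤ N) (hα : α ∈ Ioo (0 : ℝ) 1) {K : ℝ} (hK0 : 0 ≤ K)
    (hK : ∀ x, negTrunc Ω z (pt x 1) ≤ K) (hX : xc X ∈ Ω) (hX' : 1 ≤ yc X) :
    negTrunc Ω z X ≤ K := by
  by_contra! hlt
  have hX0 : 0 < yc X := by linarith
  have huc := hz.continuousAt_negTrunc hΩo
  obtain ⟨K', hK1, hK2⟩ := exists_between hlt
  have h1 : ∀ᶠ ξ in 𝓝 (0 : Euc N), K' < negTrunc Ω z (X - pt ξ 0) := by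
    refine (continuous_translate huc hX0).continuousAt.eventually (lt_mem_nhds ?_)
    simpa [sub_pt] using hK2
  obtain ⟨δ, hδ, hδ'⟩ := Metric.eventually_nhds_iff_ball.1 h1
  set r := min 1 (δ / 2)
  have hr : 0 < r := by positivity
  have h2 := hz.hAvg_le_mul hΩo hΩb hN hα hK0 hK (min_le_left 1 (δ / 2)) hX hX'
  have h3 := le_setIntegral_closedBall (K := K') (integrableOn_translate (r := r) huc hX0)
    fun ξ hξ => (hδ' ξ (closedBall_subset_ball
      (by linarith [min_le_right 1 (δ / 2)]) hξ)).le
  have hV : 0 < volume.real (closedBall (0 : Euc N) r) :=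
    ENNReal.toReal_pos (measure_closedBall_pos _ _ hr).ne' measure_closedBall_lt_top.ne
  exact absurd (h3.trans h2) (not_le.2 (mul_lt_mul_of_pos_left hK1 hV))

lemma NonnegData.exists_lower_bound (hz : NonnegData α Ω z) (hΩo : IsOpen Ω)
    (hΩb : Bornology.IsBounded Ω) (hN : 1 ≤ N) (hα : α ∈ Ioo (0 : ℝ) 1) :
    ∃ M : ℝ, ∀ X ∈ closure (cyl Ω), -M ≤ z X := by
  obtain ⟨K, hK⟩ := hΩb.isCompact_closure.exists_bound_of_continuousOn
    (hz.continuous_negTrunc_slice hΩo one_pos).continuousOn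
  have hK' : ∀ x, negTrunc Ω z (pt x 1) ≤ |K| := fun x => by
    by_cases hx : x ∈ closure Ω
    · exact (le_abs_self _).trans ((hK x hx).trans (le_abs_self K))
    · rw [negTrunc_of_notMem (by simpa using fun h => hx (subset_closure h))]
      positivity
  obtain ⟨B, hB⟩ := (isCompact_slab hΩb 0 1).exists_bound_of_continuousOn
    (hz.cont.mono fun X hX => mem_closure_cyl.2 ⟨hX.1, hX.2.1⟩)
  refine ⟨|B| + (|K| + 2), fun X hX => ?_⟩
  have hX1 := mem_closure_cyl.1 hX
  have hB0 := abs_nonneg B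
  have hK0 := abs_nonneg K
  rcases le_total (yc X) 1 with h | h
  · linarith [neg_abs_le (z X), (Real.norm_eq_abs _ ▸ hB X ⟨hX1.1, hX1.2, h⟩), le_abs_self B]
  · by_cases hXΩ : xc X ∈ Ω
    · linarith [hz.negTrunc_le hΩo hΩb hN hα hK0 hK' hXΩ h,
        neg_sub_two_le_negTrunc (z := z) (X := X) ⟨hXΩ, by linarith⟩]
    · have := hz.lateral (xc X) (by rw [hΩo.frontier_eq]; exact ⟨hX1.1, hXΩ⟩) (yc X) (by linarith)
      rw [pt_xc_yc] at this
      linarith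

lemma NonnegData.lateral_nonneg (hz : NonnegData α Ω z) {x : Euc N} (hx : x ∈ frontier Ω) {y : ℝ}
    (hy : 0 ≤ y) : 0 ≤ z (pt x y) := by
  rcases hy.eq_or_lt with rfl | hy
  swap
  · exact hz.lateral x hx y hy
  have hcl : ∀ y, 0 ≤ y → pt x y ∈ closure (cyl Ω) := fun y hy =>
    mem_closure_cyl.2 ⟨by simpa using frontier_subset_closure hx, by simpa⟩
  have h1 : Tendsto (fun y => pt x y) (𝓝[>] 0) (𝓝[closure (cyl Ω)] (pt x 0)) :=
    tendsto_nhdsWithin_iff.2 ⟨((continuous_pt.comp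
      (continuous_const.prodMk continuous_id)).tendsto 0).mono_left nhdsWithin_le_nhds,
      eventually_mem_nhdsWithin.mono fun y hy => hcl y (le_of_lt hy)⟩
  exact ge_of_tendsto ((hz.cont _ (hcl 0 le_rfl)).tendsto.comp h1)
    (eventually_mem_nhdsWithin.mono fun y hy => hz.lateral x hx y hy)

lemma barrier_pt (C : ℝ) (x : Euc N) (y : ℝ) :
    barrier α C (pt x y) = C - ‖x‖ ^ 2 + (1 / 4 * y ^ 2 - y ^ (2 * α)) := by
  rw [barrier, norm_sq_eq, xc_pt, yc_pt]
  ring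

/-- Near the base, adding a multiple of the barrier makes the solution strictly decreasing
in the vertical direction. -/
lemma NonnegData.exists_lt_base (hz : NonnegData α Ω z) (hΩo : IsOpen Ω)
    (hα : α ∈ Ioo (0 : ℝ) 1) {ε : ℝ} (hε : 0 < ε) (C : ℝ) {R : ℝ} (hR : 0 < R)
    {x : Euc N} (hx : x ∈ Ω) :
    ∃ y ∈ Icc 0 R, z (pt x y) + ε * barrier α C (pt x y) < z (pt x 0) + ε * barrier α C (pt x 0) := by
  obtain ⟨L, hL, hlim⟩ := hz.neumann x hx
  have h1 : Tendsto (fun y : ℝ => y ^ (2 - 2 * α)) (𝓝[>] 0) (𝓝 0) := by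
    have := (Real.continuousAt_rpow_const 0 (2 - 2 * α)
      (Or.inr (by linarith [hα.2]))).tendsto
    rw [Real.zero_rpow (by linarith [hα.2])] at this
    exact this.mono_left nhdsWithin_le_nhds
  have h2 := hlim.add (((h1.const_mul (1 / 2)).sub_const (2 * α)).const_mul ε)
  have h3 : L + ε * (1 / 2 * 0 - 2 * α) < 0 := by nlinarith [hα.1]
  obtain ⟨η, hη, hη'⟩ := mem_nhdsGT_iff_exists_Ioo_subset.1 (h2.eventually (gt_mem_nhds h3))
  have hη0 : 0 < η := hη
  refine ⟨min R (η / 2), ⟨by positivity, min_le_left _ _⟩, ?_⟩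
  set b := min R (η / 2)
  have hb : 0 < b := by positivity
  have hcont : ContinuousOn (fun y => z (pt x y) + ε * barrier α C (pt x y)) (Icc 0 b) := by
    have hp : Continuous fun y => pt x y :=
      continuous_pt.comp (continuous_const.prodMk continuous_id)
    refine ContinuousOn.add (hz.cont.comp hp.continuousOn fun y hy => mem_closure_cyl.2
      ⟨by simpa using subset_closure hx, by simpa using hy.1⟩) ?_
    exact (continuous_const.mul ((continuous_barrier hα.1 C).comp hp)).continuousOn
  refine strictAntiOn_of_deriv_neg (convex_Icc 0 b) hcont (fun y hy => ?_)
    (left_mem_Icc.2 hb.le) (right_mem_Icc.2 hb.le) hb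
  rw [interior_Icc] at hy
  have hy0 : 0 < y := hy.1
  have hd1 := hz.hasDerivAt_vertical hΩo hx hy0
  have hd2 : HasDerivAt (fun y => barrier α C (pt x y))
      (1 / 2 * y - 2 * α * y ^ (2 * α - 1)) y := by
    simp only [barrier_pt]
    refine ((((hasDerivAt_pow 2 y).const_mul (1 / 4)).sub
      (Real.hasDerivAt_rpow_const (Or.inl hy0.ne'))).const_add _).congr_deriv ?_
    norm_num
    ring
  rw [(HasDerivAt.fun_add hd1 (hd2.const_mul ε)).deriv]
  have hneg := hη' ⟨hy0, by linarith [hy.2, min_le_right R (η / 2)]⟩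
  simp only [mem_ofPred_eq] at hneg
  have hP : 0 < y ^ (1 - 2 * α) := Real.rpow_pos_of_pos hy0 _
  have e1 : y ^ (2 - 2 * α) = y ^ (1 - 2 * α) * y := by
    rw [← Real.rpow_add_one hy0.ne']; congr 1; ring
  have e2 : y ^ (1 - 2 * α) * y ^ (2 * α - 1) = 1 := by
    rw [← Real.rpow_add hy0]; simp
  refine neg_of_mul_neg_right (a := y ^ (1 - 2 * α)) ?_ hP.le
  refine lt_of_eq_of_lt ?_ hneg
  rw [e1]
  linear_combination (-2 * α * ε) * e2

/-- The comparison principle on the half-infinite cylinder. -/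
theorem NonnegData.nonneg (hz : NonnegData α Ω z) (hΩo : IsOpen Ω)
    (hΩb : Bornology.IsBounded Ω) (hN : 1 ≤ N) (hα : α ∈ Ioo (0 : ℝ) 1) :
    ∀ X ∈ closure (cyl Ω), 0 ≤ z X := by
  intro X hX
  have hX1 := mem_closure_cyl.1 hX
  obtain ⟨M, hM⟩ := hz.exists_lower_bound hΩo hΩb hN hα
  obtain ⟨ρ, hρ⟩ := hΩb.isCompact_closure.isBounded.exists_norm_le
  obtain ⟨C, hC⟩ := exists_barrier_ge (N := N) hα ρ
  have h : ∀ ε > 0, 0 ≤ z X + ε * barrier α C X := fun ε hε => by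
    obtain ⟨R, hXR, hR1, hR⟩ := exists_quadratic_dominates hα hε M le_rfl (yc X)
    rw [zero_mul, add_zero] at hR
    have hbar : ∀ x ∈ closure Ω, ∀ y, 0 ≤ y →
        ε * (y ^ 2 / 8) ≤ ε * barrier α C (pt x y) := fun x hx y hy => by
      have := hC (pt x y) (by simpa using hρ x hx) (by simpa)
      rw [yc_pt] at this
      gcongr
    refine nonneg_of_strict_supersolution (α := α) (f := fun Z => z Z + ε * barrier α C Z)
      hΩo hΩb (a := 0) (b := R) ?_ ?_ ?_ ?_ ?_ hX1.1 ⟨hX1.2, hXR⟩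
    · exact (hz.cont.mono fun Z hZ => mem_closure_cyl.2 ⟨hZ.1, hZ.2.1⟩).add
        (continuous_const.mul (continuous_barrier hα.1 C)).continuousOn
    · intro Z hZ hZ'
      refine ⟨_, ?_, (hz.pde Z ⟨hZ, hZ'.1⟩).add ((hasWLap_barrier C hZ'.1).const_mul ε)⟩
      linarith [barrier_wLap_neg hN hα.1 hε]
    · intro x hx y hy
      have h1 := hbar x (frontier_subset_closure hx) y hy.1
      have h2 : 0 ≤ ε * (y ^ 2 / 8) := by positivity
      linarith [hz.lateral_nonneg hx hy.1]
    · intro x hx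
      have hR0 : 0 ≤ R := by linarith
      linarith [hbar x hx R hR0, hM (pt x R) (mem_closure_cyl.2 ⟨by simpa, by simpa⟩)]
    · exact fun x hx => Or.inr (hz.exists_lt_base hΩo hα hε C (by linarith) hx)
  exact le_of_forall_le_add_mul h

end LowerBound

section Comparison

variable {α : ℝ} {Ω : Set (Euc N)} {f g : Euc (N + 1) → ℝ}

lemma fderiv_add_const_mul {X : Euc (N + 1)} (hf : DifferentiableAt ℝ f X)
    (hg : DifferentiableAt ℝ g X) (c : ℝ) :
    fderiv ℝ (fun Z => f Z + c * g Z) X = fderiv ℝ f X + c • fderiv ℝ g X :=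
  (hf.hasFDerivAt.add (hg.hasFDerivAt.const_mul c)).fderiv

lemma integrableOn_eDen_add_const_mul (hΩo : IsOpen Ω) (hf : ContDiffOn ℝ 2 f (cyl Ω))
    (hg : ContDiffOn ℝ 2 g (cyl Ω)) (hfi : IntegrableOn (eDen α f) (cyl Ω))
    (hgi : IntegrableOn (eDen α g) (cyl Ω)) (c : ℝ) :
    IntegrableOn (eDen α fun Z => f Z + c * g Z) (cyl Ω) := by
  have hopen := isOpen_cyl hΩo
  have hd : ∀ {h : Euc (N + 1) → ℝ}, ContDiffOn ℝ 2 h (cyl Ω) → ∀ X ∈ cyl Ω,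
      DifferentiableAt ℝ h X := fun hh X hX =>
    (hh.contDiffAt (hopen.mem_nhds hX)).differentiableAt (by simp)
  have hbd : IntegrableOn (fun X => 2 * eDen α f X + 2 * c ^ 2 * eDen α g X) (cyl Ω) :=
    (hfi.const_mul 2).add (hgi.const_mul (2 * c ^ 2))
  refine Integrable.mono' hbd ((continuousOn_eDen hΩo
    (hf.add (contDiffOn_const.mul hg))).aestronglyMeasurable hopen.measurableSet) ?_
  filter_upwards [ae_restrict_mem hopen.measurableSet] with X hX
  rw [Real.norm_of_nonneg (eDen_nonneg hX.2.le)]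
  have h1 : gradient (fun Z => f Z + c * g Z) X = gradient f X + c • gradient g X := by
    simp only [gradient, fderiv_add_const_mul (hd hf X hX) (hd hg X hX), map_add, map_smul]
  have h2 : ‖gradient f X + c • gradient g X‖ ≤ ‖gradient f X‖ + |c| * ‖gradient g X‖ :=
    (norm_add_le _ _).trans_eq (by rw [norm_smul, Real.norm_eq_abs])
  have h3 : ‖gradient f X + c • gradient g X‖ ^ 2 ≤
      2 * ‖gradient f X‖ ^ 2 + 2 * c ^ 2 * ‖gradient g X‖ ^ 2 := by
    have := pow_le_pow_left₀ (norm_nonneg _) h2 2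
    nlinarith [sq_nonneg (‖gradient f X‖ - |c| * ‖gradient g X‖), sq_abs c]
  have h4 : 0 ≤ yc X ^ (1 - 2 * α) := Real.rpow_nonneg hX.2.le _
  simp only [eDen, h1]
  nlinarith [mul_le_mul_of_nonneg_left h3 h4]

lemma NeumannLim.add_const_mul (hΩo : IsOpen Ω) (hf : ContDiffOn ℝ 2 f (cyl Ω))
    (hg : ContDiffOn ℝ 2 g (cyl Ω)) {x : Euc N} (hx : x ∈ Ω) {L M : ℝ}
    (hL : NeumannLim α f x L) (hM : NeumannLim α g x M) (c : ℝ) :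
    NeumannLim α (fun Z => f Z + c * g Z) x (L + c * M) := by
  refine (Tendsto.add hL (Tendsto.const_mul c hM)).congr' ?_
  filter_upwards [self_mem_nhdsWithin] with y hy
  have hmem : cyl Ω ∈ 𝓝 (pt x y) := (isOpen_cyl hΩo).mem_nhds ⟨by simpa, by simpa using hy⟩
  rw [fderiv_add_const_mul ((hf.contDiffAt hmem).differentiableAt (by simp))
    ((hg.contDiffAt hmem).differentiableAt (by simp))]
  simp only [add_apply, smul_apply, smul_eq_mul]
  ring

/-- If `w` solves the linear problem on a larger cylinder with datum at least `|φ|`, where `φ` is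
the flux of `v`, then `w ± v` is nonnegative data on the smaller cylinder. -/
lemma LinSol.nonnegData_add_const_mul {lam p : ℝ} {D : Set (Euc N)} {F : Euc N → ℝ}
    {v w : Euc (N + 1) → ℝ} (hΩo : IsOpen Ω) (hDo : IsOpen D) (hΩD : closure Ω ⊆ D)
    (hv : ExtSol N α lam p Ω v) (hw : LinSol N α D F w) (hw0 : ∀ X ∈ closure (cyl D), 0 ≤ w X)
    (hF : ∀ x ∈ Ω, |(|v (pt x 0)| ^ (p - 2) * v (pt x 0) + lam * v (pt x 0))| ≤ F x)
    {c : ℝ} (hc : |c| = 1) : NonnegData α Ω fun Z => w Z + c * v Z := by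
  have hsub : cyl Ω ⊆ cyl D := fun X hX => ⟨hΩD (subset_closure hX.1), hX.2⟩
  have hws := hw.smooth.mono hsub
  refine ⟨(hw.cont.mono (closure_mono hsub)).add (continuousOn_const.mul hv.cont),
    hws.add (contDiffOn_const.mul hv.smooth),
    integrableOn_eDen_add_const_mul hΩo hws hv.smooth (hw.energy.mono_set hsub) hv.energy c,
    fun X hX => ?_, fun x hx y hy => ?_, fun x hx => ⟨_, ?_, (hw.neumann x
      (hΩD (subset_closure hx))).add_const_mul hΩo hws hv.smooth hx (hv.neumann x hx) c⟩⟩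
  · have h1 : ContDiffAt ℝ 2 w X := hw.smooth.contDiffAt ((isOpen_cyl hDo).mem_nhds (hsub hX))
    have h2 : ContDiffAt ℝ 2 v X := hv.smooth.contDiffAt ((isOpen_cyl hΩo).mem_nhds hX)
    have h3 := (hasWLap_wLap (α := α) h1).add ((hasWLap_wLap h2).const_mul c)
    rwa [wLap_eq_zero h1 hX.2 (hw.pde X (hsub hX)), wLap_eq_zero h2 hX.2 (hv.pde X hX), mul_zero,
      add_zero] at h3
  · rw [hv.lateral x hx y hy, mul_zero, add_zero]
    exact hw0 _ (subset_closure ⟨by simpa using hΩD (frontier_subset_closure hx), by simpa⟩)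
  · have h1 := (neg_le_abs (c * (|v (pt x 0)| ^ (p - 2) * v (pt x 0) + lam * v (pt x 0)))).trans_eq
      (abs_mul _ _)
    rw [hc, one_mul] at h1
    linarith [hF x hx]

end Comparison

end Preparation

/-- comparison principle — the dominating solution `w` on `C_D` with
Neumann datum `2|v(x,0)|^{2*_α-1} + A` dominates `|v|` on the closure of `C_Ω`. -/
theorem comparison_with_dominating_solution
    (N : ℕ) (α : ℝ) (hα : α ∈ Set.Ioo (0 : ℝ) 1) (hN : 2 * α < (N : ℝ))
    (lam p : ℝ) (hp : p ∈ Set.Ioc (2 : ℝ) (critExp N α))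
    (Ω D : Set (Euc N)) (hΩo : IsOpen Ω) (hΩb : Bornology.IsBounded Ω) (hΩne : Ω.Nonempty)
    (hDo : IsOpen D) (hDb : Bornology.IsBounded D) (hΩD : closure Ω ⊆ D)
    (A : ℝ) (hA : 0 < A)
    (hAbound : ∀ t : ℝ,
      abs (|t| ^ (p - 2) * t + lam * t) ≤ 2 * |t| ^ (critExp N α - 1) + A)
    (v : Euc (N + 1) → ℝ) (hv : ExtSol N α lam p Ω v)
    (w : Euc (N + 1) → ℝ)
    (hw : LinSol N α D
      (fun x => 2 * |Ω.indicator (fun x' => v (pt x' 0)) x| ^ (critExp N α - 1) + A) w)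
    (hw0 : ∀ X ∈ closure (cyl D), 0 ≤ w X) :
    ∀ X ∈ closure (cyl Ω), |v X| ≤ w X := by
  have hN1 : 1 ≤ N := by
    have : (0 : ℝ) < N := by linarith [hα.1]
    exact_mod_cast this
  have hF : ∀ x ∈ Ω, |(|v (pt x 0)| ^ (p - 2) * v (pt x 0) + lam * v (pt x 0))| ≤
      2 * |Ω.indicator (fun x' => v (pt x' 0)) x| ^ (critExp N α - 1) + A := fun x hx => by
    rw [indicator_of_mem hx]
    exact hAbound _
  intro X hX
  have h1 := (hw.nonnegData_add_const_mul hΩo hDo hΩD hv hw0 hF (c := 1)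
    (by simp)).nonneg hΩo hΩb hN1 hα X hX
  have h2 := (hw.nonnegData_add_const_mul hΩo hDo hΩD hv hw0 hF (c := -1)
    (by simp)).nonneg hΩo hΩb hN1 hα X hX
  exact abs_le.2 ⟨by linarith, by linarith⟩

end
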